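/- Let d ≥ 1, n ≥ 1, and let f = (1/n)·Σ_{i=1}^n f_i, where each f_i : ℝ^d → ℝ is ℓ-smooth, twice continuously differentiable and ρ-Hessian Lipschitz. Fix x ∈ ℝ^d and σ ≥ 0 with (1/n)·Σ_{i=1}^n ‖∇f_i(x) − ∇f(x)‖² ≤ σ². Let S be a uniformly random subset of {1,…,n} of cardinality B (1 ≤ B ≤ n) and consider the zeroth-order stochastic gradient step x' = x − η·(1/B)·Σ_{i∈S} ∇̂_coord f_i(x) with η > 0 and smoothing parameter μ > 0. Then f(x) − E_S[f(x')] ≥ ((η − 2η²ℓ)/2)·‖∇f(x)‖² − (η/2 + 2η²ℓ)·ρ² d μ⁴/36 − 2η²ℓσ²/B. -/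

import Mathlib

/-- The central-difference coordinate-wise gradient estimator
`∇̂_coord g(x) = Σ_i ((g(x+μeᵢ) − g(x−μeᵢ))/(2μ)) eᵢ`. -/
noncomputable def coordGrad (d : ℕ) (g : EuclideanSpace ℝ (Fin d) → ℝ) (μ : ℝ)
    (x : EuclideanSpace ℝ (Fin d)) : EuclideanSpace ℝ (Fin d) :=
  ∑ i : Fin d,
    ((g (x + μ • EuclideanSpace.single i 1) - g (x - μ • EuclideanSpace.single i 1)) / (2 * μ))
      • EuclideanSpace.single i 1

/-- A function on `ℝ` with nonnegative derivative on `[0, ∞)` is nonnegative on `[0, ∞)` as soon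
as it vanishes at `0`. -/
theorem nonneg_of_hasDerivAt_nonneg {h h' : ℝ → ℝ} (h0 : h 0 = 0)
    (hd : ∀ t, HasDerivAt h (h' t) t) (hn : ∀ t, 0 ≤ t → 0 ≤ h' t) {t : ℝ} (ht : 0 ≤ t) :
    0 ≤ h t := by
  have hmono : MonotoneOn h (Set.Ici 0) :=
    monotoneOn_of_hasDerivWithinAt_nonneg (convex_Ici 0)
      (fun y _ => (hd y).continuousAt.continuousWithinAt)
      (fun y _ => (hd y).hasDerivWithinAt) fun y hy => hn y (interior_subset hy)
  simpa [h0] using hmono (Set.mem_Ici.2 le_rfl) (Set.mem_Ici.2 ht) ht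

/-- Error of the central difference for a function with `ρ`-Lipschitz second derivative. -/
theorem abs_central_difference_sub_le {φ φ' φ'' : ℝ → ℝ} {ρ : ℝ}
    (h1 : ∀ t, HasDerivAt φ (φ' t) t) (h2 : ∀ t, HasDerivAt φ' (φ'' t) t)
    (hL : ∀ s t, |φ'' s - φ'' t| ≤ ρ * |s - t|) {μ : ℝ} (hμ : 0 < μ) :
    |(φ μ - φ (-μ)) / (2 * μ) - φ' 0| ≤ ρ * μ ^ 2 / 6 := by
  have h1n (t : ℝ) : HasDerivAt (fun s => φ (-s)) (-φ' (-t)) t := by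
    simpa [Function.comp_def] using (h1 (-t)).comp t (hasDerivAt_neg t)
  have h2n (t : ℝ) : HasDerivAt (fun s => φ' (-s)) (-φ'' (-t)) t := by
    simpa [Function.comp_def] using (h2 (-t)).comp t (hasDerivAt_neg t)
  have hbd (t : ℝ) (ht : 0 ≤ t) : |φ'' t - φ'' (-t)| ≤ 2 * ρ * t := by
    have := hL t (-t)
    rw [show t - -t = 2 * t by ring, abs_of_nonneg (by positivity : 0 ≤ 2 * t)] at this
    linarith
  have hsq (t : ℝ) : HasDerivAt (fun s : ℝ => ρ * s ^ 2) (2 * ρ * t) t :=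
    ((hasDerivAt_pow 2 t).const_mul ρ).congr_deriv (by simp; ring)
  have hcu (t : ℝ) : HasDerivAt (fun s : ℝ => ρ / 3 * s ^ 3) (ρ * t ^ 2) t :=
    ((hasDerivAt_pow 3 t).const_mul (ρ / 3)).congr_deriv (by simp; ring)
  have hψ' (t : ℝ) : HasDerivAt (fun s => φ' s + φ' (-s) - 2 * φ' 0)
      (φ'' t + -φ'' (-t)) t := ((h2 t).add (h2n t)).sub_const _
  have hψ (t : ℝ) : HasDerivAt (fun s => φ s - φ (-s) - s * (2 * φ' 0))
      (φ' t - -φ' (-t) - 1 * (2 * φ' 0)) t :=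
    ((h1 t).sub (h1n t)).sub ((hasDerivAt_id t).mul_const _)
  have hup' (t : ℝ) (ht : 0 ≤ t) : 0 ≤ ρ * t ^ 2 - (φ' t + φ' (-t) - 2 * φ' 0) :=
    nonneg_of_hasDerivAt_nonneg (by simp; ring) (fun s => (hsq s).sub (hψ' s))
      (fun s hs => by linarith [(abs_le.1 (hbd s hs)).2]) ht
  have hlo' (t : ℝ) (ht : 0 ≤ t) : 0 ≤ ρ * t ^ 2 + (φ' t + φ' (-t) - 2 * φ' 0) :=
    nonneg_of_hasDerivAt_nonneg (by simp; ring) (fun s => (hsq s).add (hψ' s))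
      (fun s hs => by linarith [(abs_le.1 (hbd s hs)).1]) ht
  have hup : 0 ≤ ρ / 3 * μ ^ 3 - (φ μ - φ (-μ) - μ * (2 * φ' 0)) :=
    nonneg_of_hasDerivAt_nonneg (by simp) (fun s => (hcu s).sub (hψ s))
      (fun s hs => by linarith [hup' s hs]) hμ.le
  have hlo : 0 ≤ ρ / 3 * μ ^ 3 + (φ μ - φ (-μ) - μ * (2 * φ' 0)) :=
    nonneg_of_hasDerivAt_nonneg (by simp) (fun s => (hcu s).add (hψ s))
      (fun s hs => by linarith [hlo' s hs]) hμ.le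
  have hrw : (φ μ - φ (-μ)) / (2 * μ) - φ' 0 = (φ μ - φ (-μ) - μ * (2 * φ' 0)) / (2 * μ) := by
    field_simp
  rw [hrw, abs_div, abs_of_pos (by positivity : 0 < 2 * μ), div_le_iff₀ (by positivity), abs_le]
  constructor <;> nlinarith

section InnerProductSpace

variable {E : Type*} [NormedAddCommGroup E] [InnerProductSpace ℝ E]

section Gradient

variable [CompleteSpace E]

/-- The derivative of a function along a line, through its gradient. -/
theorem hasDerivAt_comp_line {g : E → ℝ} (hg : Differentiable ℝ g) (x v : E) (t : ℝ) :
    HasDerivAt (fun s : ℝ => g (x + s • v)) (inner ℝ (gradient g (x + t • v)) v) t := by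
  have hline : HasDerivAt (fun s : ℝ => x + s • v) v t := by
    simpa using ((hasDerivAt_id t).smul_const v).const_add x
  rw [inner_gradient_left]
  exact (hg (x + t • v)).hasFDerivAt.comp_hasDerivAt t hline

/-- The descent lemma: the quadratic upper bound for a function with Lipschitz gradient. -/
theorem le_add_inner_gradient_add_sq {g : E → ℝ} {ℓ : ℝ} (hg : Differentiable ℝ g)
    (hL : ∀ x y, ‖gradient g x - gradient g y‖ ≤ ℓ * ‖x - y‖) (x v : E) :
    g (x + v) ≤ g x + inner ℝ (gradient g x) v + ℓ / 2 * ‖v‖ ^ 2 := by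
  have hsq (t : ℝ) : HasDerivAt (fun s : ℝ => ℓ / 2 * ‖v‖ ^ 2 * s ^ 2) (ℓ * ‖v‖ ^ 2 * t) t :=
    ((hasDerivAt_pow 2 t).const_mul (ℓ / 2 * ‖v‖ ^ 2)).congr_deriv (by simp; ring)
  have hlin (t : ℝ) : HasDerivAt (fun s : ℝ => s * inner ℝ (gradient g x) v)
      (1 * inner ℝ (gradient g x) v) t := (hasDerivAt_id t).mul_const _
  have := nonneg_of_hasDerivAt_nonneg
    (h := fun s => ℓ / 2 * ‖v‖ ^ 2 * s ^ 2 + s * inner ℝ (gradient g x) v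
      - (g (x + s • v) - g x)) (by simp)
    (fun t => ((hsq t).add (hlin t)).sub ((hasDerivAt_comp_line hg x v t).sub_const _))
    (fun t ht => by
      have h1 := real_inner_le_norm (gradient g (x + t • v) - gradient g x) v
      rw [inner_sub_left] at h1
      have h2 := hL (x + t • v) x
      rw [add_sub_cancel_left, norm_smul, Real.norm_of_nonneg ht] at h2
      nlinarith [mul_le_mul_of_nonneg_right h2 (norm_nonneg v)]) zero_le_one
  simp only [one_smul] at this
  linarith

theorem differentiable_gradient {g : E → ℝ} (hg : ContDiff ℝ 2 g) :
    Differentiable ℝ (gradient g) :=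
  (InnerProductSpace.toDual ℝ E).symm.toContinuousLinearEquiv.differentiable.comp
    ((hg.fderiv_right (m := 1) (by norm_num)).differentiable (by norm_num))

/-- Error of the central difference along a unit vector, for a function with Lipschitz Hessian. -/
theorem abs_central_difference_sub_inner_gradient_le {g : E → ℝ} {ρ : ℝ} (hg : ContDiff ℝ 2 g)
    (hL : ∀ x y, ‖fderiv ℝ (gradient g) x - fderiv ℝ (gradient g) y‖ ≤ ρ * ‖x - y‖)
    (x : E) {e : E} (he : ‖e‖ = 1) {μ : ℝ} (hμ : 0 < μ) :
    |(g (x + μ • e) - g (x - μ • e)) / (2 * μ) - inner ℝ (gradient g x) e| ≤ ρ * μ ^ 2 / 6 := by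
  have h2 (t : ℝ) : HasDerivAt (fun s : ℝ => inner ℝ (gradient g (x + s • e)) e)
      (inner ℝ (fderiv ℝ (gradient g) (x + t • e) e) e) t := by
    have hline : HasDerivAt (fun s : ℝ => x + s • e) e t := by
      simpa using ((hasDerivAt_id t).smul_const e).const_add x
    have := ((differentiable_gradient hg (x + t • e)).hasFDerivAt.comp_hasDerivAt t hline).inner ℝ
      (hasDerivAt_const t e)
    simpa using this
  have := abs_central_difference_sub_le
    (hasDerivAt_comp_line (hg.differentiable (by norm_num)) x e) h2 (ρ := ρ)
    (fun s t => by
      rw [← inner_sub_left, ← sub_apply]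
      refine (abs_real_inner_le_norm _ _).trans ?_
      rw [he, mul_one]
      refine (ContinuousLinearMap.le_opNorm _ _).trans ?_
      rw [he, mul_one]
      refine (hL _ _).trans_eq ?_
      rw [add_sub_add_left_eq_sub, ← sub_smul, norm_smul, he, mul_one, Real.norm_eq_abs]) hμ
  simpa [← sub_eq_add_neg] using this

end Gradient

open Finset in
theorem sum_powersetCard_sum {ι : Type*} [Fintype ι] {M : Type*} [AddCommMonoid M] (a : ι → M)
    {B : ℕ} (hB : 1 ≤ B) :
    ∑ S ∈ powersetCard B (univ : Finset ι), ∑ i ∈ S, a i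
      = (Fintype.card ι - 1).choose (B - 1) • ∑ i, a i := by
  classical
  calc
    _ = ∑ S ∈ powersetCard B (univ : Finset ι), ∑ i, if i ∈ S then a i else 0 := by simp
    _ = ∑ i, ∑ S ∈ powersetCard B (univ : Finset ι), if {i} ⊆ S then a i else 0 := by
      rw [sum_comm]; simp
    _ = _ := by
      rw [smul_sum]
      refine sum_congr rfl fun i _ => ?_
      rw [← sum_filter, sum_const, card_filter_powersetCard_subset _ _ _ (subset_univ _) (by simpa)]
      simp

open Finset in
/-- Second moment of a sum sampled without replacement from a family with zero sum. -/
theorem sum_powersetCard_norm_sum_sq_le {ι : Type*} [Fintype ι] (w : ι → E)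
    (hw : ∑ i, w i = 0) {B : ℕ} (hB : 1 ≤ B) :
    ∑ S ∈ powersetCard B (univ : Finset ι), ‖∑ i ∈ S, w i‖ ^ 2
      ≤ (Fintype.card ι - 1).choose (B - 1) * ∑ i, ‖w i‖ ^ 2 := by
  classical
  obtain ⟨c, hc⟩ : ∃ c : ℕ, ∀ i j : ι, i ≠ j →
      #{S ∈ powersetCard B (univ : Finset ι) | {i, j} ⊆ S} = c := by
    rcases lt_or_ge B 2 with h | h
    · refine ⟨0, fun i j hij => ?_⟩
      rw [card_eq_zero, filter_eq_empty_iff]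
      intro S hS hsub
      have := card_le_card hsub
      rw [card_pair hij, (mem_powersetCard.1 hS).2] at this
      omega
    · refine ⟨(Fintype.card ι - 2).choose (B - 2), fun i j hij => ?_⟩
      rw [card_filter_powersetCard_subset _ _ _ (subset_univ _) (by rwa [card_pair hij]),
        card_pair hij, card_univ]
  have hexp (S : Finset ι) : ‖∑ i ∈ S, w i‖ ^ 2
      = ∑ i, ∑ j, if {i, j} ⊆ S then inner ℝ (w i) (w j) else 0 := by
    rw [← real_inner_self_eq_norm_sq, sum_inner]
    simp only [inner_sum, insert_subset_iff, singleton_subset_iff, ite_and]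
    simp
  have hpair (i j : ι) : (∑ S ∈ powersetCard B (univ : Finset ι),
      if {i, j} ⊆ S then inner ℝ (w i) (w j) else 0)
      = c * inner ℝ (w i) (w j) + if i = j then
        (((Fintype.card ι - 1).choose (B - 1) : ℕ) - c : ℝ) * ‖w i‖ ^ 2 else 0 := by
    rw [← sum_filter, sum_const, nsmul_eq_mul]
    split_ifs with h
    · subst h
      rw [pair_eq_singleton, card_filter_powersetCard_subset _ _ _ (subset_univ _) (by simpa),
        real_inner_self_eq_norm_sq, card_singleton, card_univ]
      ring
    · rw [hc i j h, add_zero]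
  calc
    _ = ∑ i, ∑ j, ∑ S ∈ powersetCard B (univ : Finset ι),
        if {i, j} ⊆ S then inner ℝ (w i) (w j) else 0 := by
      simp_rw [hexp]
      rw [sum_comm]
      exact sum_congr rfl fun i _ => sum_comm
    _ = (((Fintype.card ι - 1).choose (B - 1) : ℕ) - c : ℝ) * ∑ i, ‖w i‖ ^ 2 := by
      simp_rw [hpair, sum_add_distrib, ← mul_sum, ← inner_sum, hw]
      simp [mul_sum]
    _ ≤ _ := by
      gcongr
      simp

/-- An average of vectors of norm at most `b` has norm at most `b`. -/
theorem norm_inv_card_smul_sum_le {ι : Type*} {S : Finset ι} {u : ι → E} {b : ℝ}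
    (hS : S.Nonempty) (hu : ∀ i, ‖u i‖ ≤ b) : ‖(S.card : ℝ)⁻¹ • ∑ i ∈ S, u i‖ ≤ b := by
  have hcard : (0 : ℝ) < S.card := by exact_mod_cast hS.card_pos
  rw [norm_smul, norm_inv, Real.norm_of_nonneg hcard.le, inv_mul_le_iff₀ hcard]
  simpa using norm_sum_le_of_le S fun i _ => hu i

end InnerProductSpace

theorem norm_sq_le_two_mul_add_four_mul {E : Type*} [SeminormedAddCommGroup E]
    (v a g : E) :
    ‖v‖ ^ 2 ≤ 2 * ‖g‖ ^ 2 + 4 * ‖v - a‖ ^ 2 + 4 * ‖a - g‖ ^ 2 := by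
  have h := norm_add₃_le (a := v - a) (b := a - g) (c := g)
  rw [sub_add_sub_cancel, sub_add_cancel] at h
  have := norm_nonneg v
  nlinarith [sq_nonneg (‖v - a‖ - ‖a - g‖), sq_nonneg (‖v - a‖ + ‖a - g‖ - ‖g‖)]

theorem norm_coordGrad_sub_gradient_sq_le {d : ℕ} {g : EuclideanSpace ℝ (Fin d) → ℝ} {ρ : ℝ}
    (hg : ContDiff ℝ 2 g)
    (hL : ∀ x y, ‖fderiv ℝ (gradient g) x - fderiv ℝ (gradient g) y‖ ≤ ρ * ‖x - y‖)
    (x : EuclideanSpace ℝ (Fin d)) {μ : ℝ} (hμ : 0 < μ) :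
    ‖coordGrad d g μ x - gradient g x‖ ^ 2 ≤ ρ ^ 2 * d * μ ^ 4 / 36 := by
  have hcoord (i : Fin d) : ‖(coordGrad d g μ x - gradient g x) i‖ ^ 2
      ≤ (ρ * μ ^ 2 / 6) ^ 2 := by
    have h := abs_central_difference_sub_inner_gradient_le hg hL x
      (e := EuclideanSpace.single i (1 : ℝ)) (by simp) hμ
    have hi : coordGrad d g μ x i = (g (x + μ • EuclideanSpace.single i 1)
        - g (x - μ • EuclideanSpace.single i 1)) / (2 * μ) := by
      simp [coordGrad, Pi.single_apply]
    rw [EuclideanSpace.inner_single_right, ← hi] at h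
    gcongr
    simpa using h
  rw [EuclideanSpace.norm_sq_eq]
  refine (Finset.sum_le_sum fun i _ => hcoord i).trans_eq ?_
  simp; ring

/-- The gradient of an average of differentiable functions. -/
theorem gradient_average {E : Type*} [NormedAddCommGroup E] [InnerProductSpace ℝ E]
    [CompleteSpace E] {ι : Type*} [Fintype ι] {fs : ι → E → ℝ}
    (hf : ∀ i, Differentiable ℝ (fs i)) (c : ℝ) (x : E) :
    gradient (fun y => (∑ i, fs i y) / c) x = c⁻¹ • ∑ i, gradient (fs i) x := by
  have h : HasFDerivAt (fun y => (∑ i, fs i y) / c) (c⁻¹ • ∑ i, fderiv ℝ (fs i) x) x := by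
    simp_rw [div_eq_inv_mul]
    exact (HasFDerivAt.fun_sum fun i _ => (hf i x).hasFDerivAt).const_mul c⁻¹
  simp [gradient, h.fderiv, map_sum]

theorem cast_choose_pred_mul {n B : ℕ} (hn : 1 ≤ n) (hB : 1 ≤ B) :
    ((n - 1).choose (B - 1) : ℝ) * n = n.choose B * B := by
  obtain ⟨m, rfl⟩ := Nat.exists_eq_add_of_le' hn
  obtain ⟨k, rfl⟩ := Nat.exists_eq_add_of_le' hB
  exact_mod_cast (mul_comm _ _).trans (Nat.add_one_mul_choose_eq m k)

open Finset in
/-- Variance of the mean of a batch sampled without replacement. -/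
theorem sum_powersetCard_norm_batch_sub_sq_le {E : Type*} [NormedAddCommGroup E]
    [InnerProductSpace ℝ E] {n B : ℕ} (hn : 1 ≤ n) (hB : 1 ≤ B) {a : Fin n → E} {g : E}
    (hg : g = (n : ℝ)⁻¹ • ∑ i, a i) {s : ℝ} (hvar : (∑ i, ‖a i - g‖ ^ 2) / n ≤ s) :
    ∑ S ∈ powersetCard B (univ : Finset (Fin n)), ‖(B : ℝ)⁻¹ • ∑ i ∈ S, a i - g‖ ^ 2
      ≤ n.choose B * (s / B) := by
  have hn0 : (0 : ℝ) < n := by exact_mod_cast hn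
  have hB0 : (0 : ℝ) < B := by exact_mod_cast hB
  have hchoose := cast_choose_pred_mul hn hB
  have hw : ∑ i, (a i - g) = 0 := by
    rw [sum_sub_distrib, hg, sum_const, card_univ, Fintype.card_fin, ← Nat.cast_smul_eq_nsmul ℝ,
      smul_inv_smul₀ hn0.ne', sub_self]
  have hsum := sum_powersetCard_norm_sum_sq_le (fun i => a i - g) hw hB
  rw [Fintype.card_fin] at hsum
  have hS (S : Finset (Fin n)) (hS : S ∈ powersetCard B (univ : Finset (Fin n))) :
      ‖(B : ℝ)⁻¹ • ∑ i ∈ S, a i - g‖ ^ 2 = (B : ℝ)⁻¹ ^ 2 * ‖∑ i ∈ S, (a i - g)‖ ^ 2 := by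
    rw [sum_sub_distrib, sum_const, (mem_powersetCard.1 hS).2, ← Nat.cast_smul_eq_nsmul ℝ,
      ← mul_pow, ← Real.norm_of_nonneg (inv_nonneg.2 hB0.le), ← norm_smul, smul_sub,
      Real.norm_of_nonneg (inv_nonneg.2 hB0.le), inv_smul_smul₀ hB0.ne']
  rw [sum_congr rfl hS, ← mul_sum]
  rw [div_le_iff₀ hn0] at hvar
  calc
    _ ≤ (B : ℝ)⁻¹ ^ 2 * ((n - 1).choose (B - 1) * (s * n)) := by
      gcongr
      exact hsum.trans (by gcongr)
    _ = (B : ℝ)⁻¹ ^ 2 * (((n - 1).choose (B - 1) * n) * s) := by ring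
    _ = _ := by rw [hchoose]; field_simp

open Finset in
/-- The batch mean is an unbiased estimator of the mean. -/
theorem sum_powersetCard_batch {E : Type*} [AddCommGroup E] [Module ℝ E] {n B : ℕ} (hn : 1 ≤ n)
    (hB : 1 ≤ B) (a : Fin n → E) :
    ∑ S ∈ powersetCard B (univ : Finset (Fin n)), (B : ℝ)⁻¹ • ∑ i ∈ S, a i
      = (n.choose B : ℝ) • (n : ℝ)⁻¹ • ∑ i, a i := by
  have hn0 : (n : ℝ) ≠ 0 := by positivity
  have hB0 : (B : ℝ) ≠ 0 := by positivity
  have hchoose := cast_choose_pred_mul hn hB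
  rw [← smul_sum, sum_powersetCard_sum a hB, Fintype.card_fin, ← Nat.cast_smul_eq_nsmul ℝ,
    smul_smul, smul_smul]
  congr 1
  field_simp
  linarith

/-- Expected descent of the zeroth-order stochastic gradient step: with `f = (1/n)Σᵢ fᵢ`,
each `fᵢ` `ℓ`-smooth, C² and `ρ`-Hessian Lipschitz, gradient variance bound `σ²` at `x`,
and `S` a uniformly random subset of `{1,…,n}` of cardinality `B`, the step
`x' = x − η·(1/B)Σ_{i∈S} ∇̂_coord fᵢ(x)` satisfies
`f(x) − E_S[f(x')] ≥ ((η − 2η²ℓ)/2)‖∇f(x)‖² − (η/2 + 2η²ℓ)ρ²dμ⁴/36 − 2η²ℓσ²/B`,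
where the expectation over `S` is the average over all subsets of cardinality `B`. -/
theorem zo_sgd_expected_descent (d n B : ℕ) (hd : 1 ≤ d) (hn : 1 ≤ n)
    (hB1 : 1 ≤ B) (hBn : B ≤ n)
    (fs : Fin n → EuclideanSpace ℝ (Fin d) → ℝ) (ℓ ρ σ : ℝ) (hσ : 0 ≤ σ)
    (hf : ∀ i, ContDiff ℝ 2 (fs i))
    (hGradLip : ∀ i, ∀ x y : EuclideanSpace ℝ (Fin d),
      ‖gradient (fs i) x - gradient (fs i) y‖ ≤ ℓ * ‖x - y‖)
    (hHessLip : ∀ i, ∀ x y : EuclideanSpace ℝ (Fin d),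
      ‖fderiv ℝ (gradient (fs i)) x - fderiv ℝ (gradient (fs i)) y‖ ≤ ρ * ‖x - y‖)
    (f : EuclideanSpace ℝ (Fin d) → ℝ) (hfdef : f = fun y => (∑ i, fs i y) / n)
    (x : EuclideanSpace ℝ (Fin d))
    (hvar : (∑ i, ‖gradient (fs i) x - gradient f x‖ ^ 2) / n ≤ σ ^ 2)
    (η μ : ℝ) (hη : 0 < η) (hμ : 0 < μ) :
    f x - (∑ S ∈ Finset.powersetCard B (Finset.univ : Finset (Fin n)),
            f (x - η • ((B : ℝ)⁻¹ • ∑ i ∈ S, coordGrad d (fs i) μ x))) / (n.choose B)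
      ≥ (η - 2 * η ^ 2 * ℓ) / 2 * ‖gradient f x‖ ^ 2
        - (η / 2 + 2 * η ^ 2 * ℓ) * (ρ ^ 2 * d * μ ^ 4 / 36)
        - 2 * η ^ 2 * ℓ * σ ^ 2 / B := by
  have hn0 : (0 : ℝ) < n := by exact_mod_cast hn
  have hN : (0 : ℝ) < n.choose B := by exact_mod_cast Nat.choose_pos hBn
  have hdiff (i : Fin n) : Differentiable ℝ (fs i) := (hf i).differentiable (by norm_num)
  have hgrad (y : EuclideanSpace ℝ (Fin d)) :
      gradient f y = (n : ℝ)⁻¹ • ∑ i, gradient (fs i) y := by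
    rw [hfdef, gradient_average hdiff]
  have hfdiff : Differentiable ℝ f := by
    rw [hfdef]
    simp_rw [div_eq_mul_inv]
    exact (Differentiable.fun_sum fun i _ => hdiff i).mul_const _
  have hne : (Finset.univ : Finset (Fin n)).Nonempty := ⟨⟨0, hn⟩, Finset.mem_univ _⟩
  have hmean {u : Fin n → EuclideanSpace ℝ (Fin d)} {b : ℝ} (hu : ∀ i, ‖u i‖ ≤ b) :
      ‖(n : ℝ)⁻¹ • ∑ i, u i‖ ≤ b := by
    simpa using norm_inv_card_smul_sum_le hne hu
  have hfLip (y z : EuclideanSpace ℝ (Fin d)) :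
      ‖gradient f y - gradient f z‖ ≤ ℓ * ‖y - z‖ := by
    rw [hgrad, hgrad, ← smul_sub, ← Finset.sum_sub_distrib]
    exact hmean fun i => hGradLip i y z
  have hℓ : 0 ≤ ℓ := by
    simpa using (norm_nonneg _).trans (hfLip (EuclideanSpace.single ⟨0, hd⟩ 1) 0)
  set β := ρ ^ 2 * d * μ ^ 4 / 36 with hβ
  set g := gradient f x
  set v := fun i => coordGrad d (fs i) μ x
  set V := fun S : Finset (Fin n) => (B : ℝ)⁻¹ • ∑ i ∈ S, v i
  set A := fun S : Finset (Fin n) => (B : ℝ)⁻¹ • ∑ i ∈ S, gradient (fs i) x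
  have hβ0 : 0 ≤ β := by positivity
  have hbias (i : Fin n) : ‖v i - gradient (fs i) x‖ ≤ √β :=
    Real.le_sqrt_of_sq_le (norm_coordGrad_sub_gradient_sq_le (hf i) (hHessLip i) x hμ)
  have hVA (S : Finset (Fin n)) (hS : S ∈ Finset.powersetCard B Finset.univ) :
      ‖V S - A S‖ ^ 2 ≤ β := by
    have hcard := (Finset.mem_powersetCard.1 hS).2
    refine (Real.le_sqrt (norm_nonneg _) hβ0).1 ?_
    simp only [V, A]
    rw [← smul_sub, ← Finset.sum_sub_distrib, ← hcard]
    exact norm_inv_card_smul_sum_le (Finset.card_pos.1 (by omega)) hbias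
  have hinner : (‖g‖ ^ 2 - β) / 2 ≤ inner ℝ g ((n : ℝ)⁻¹ • ∑ i, v i) := by
    have h : ‖(n : ℝ)⁻¹ • ∑ i, v i - g‖ ^ 2 ≤ β := by
      refine (Real.le_sqrt (norm_nonneg _) hβ0).1 ?_
      rw [show g = _ from hgrad x, ← smul_sub, ← Finset.sum_sub_distrib]
      exact hmean hbias
    rw [norm_sub_sq_real, real_inner_comm] at h
    linarith [sq_nonneg ‖(n : ℝ)⁻¹ • ∑ i, v i‖]
  have hstep (S : Finset (Fin n)) (hS : S ∈ Finset.powersetCard B Finset.univ) :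
      f (x - η • V S) ≤ f x - η * inner ℝ g (V S)
        + ℓ / 2 * η ^ 2 * (2 * ‖g‖ ^ 2 + 4 * β + 4 * ‖A S - g‖ ^ 2) := by
    have h := le_add_inner_gradient_add_sq hfdiff hfLip x (-(η • V S))
    rw [← sub_eq_add_neg, inner_neg_right, real_inner_smul_right, norm_neg, norm_smul, mul_pow,
      Real.norm_of_nonneg hη.le] at h
    have h2 : ‖V S‖ ^ 2 ≤ 2 * ‖g‖ ^ 2 + 4 * β + 4 * ‖A S - g‖ ^ 2 := by
      linarith [norm_sq_le_two_mul_add_four_mul (V S) (A S) g, hVA S hS]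
    have h3 := mul_le_mul_of_nonneg_left h2 (by positivity : 0 ≤ ℓ / 2 * η ^ 2)
    linarith
  have hvarS := sum_powersetCard_norm_batch_sub_sq_le hn hB1 (hgrad x) hvar
  have hsum := Finset.sum_le_sum hstep
  rw [Finset.sum_add_distrib, Finset.sum_sub_distrib, ← Finset.mul_sum, ← Finset.mul_sum,
    ← inner_sum, sum_powersetCard_batch hn hB1, Finset.sum_add_distrib, ← Finset.mul_sum,
    Finset.sum_const, Finset.sum_const, Finset.card_powersetCard, Finset.card_univ,
    Fintype.card_fin, real_inner_smul_right, nsmul_eq_mul, nsmul_eq_mul] at hsum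
  have hvar' := mul_le_mul_of_nonneg_left hvarS (by positivity : 0 ≤ 2 * ℓ * η ^ 2)
  have hinner' := mul_le_mul_of_nonneg_left hinner (by positivity : 0 ≤ η * n.choose B)
  rw [ge_iff_le, le_sub_comm, div_le_iff₀ hN]
  refine hsum.trans ?_
  rw [mul_div_assoc _ (σ ^ 2)]
  linarith
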